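/- Define $\nu_{\Lambda}(n) := \int_1^\infty \frac{\log n}{\zeta(s)\, n^s}\, ds$ for natural numbers $n > 1$, where $\zeta(s) = \sum_{k \geq 1} k^{-s}$. Then there is an absolute constant $C$ such that for all natural numbers $n \geq 2$, $\left| \nu_{\Lambda}(n) - \left(1 - \frac{2\gamma}{\log n}\right) \frac{1}{n \log n} \right| \leq \frac{C}{n \log^3 n}$, where $\gamma$ is the Euler–Mascheroni constant. -/

import Mathlib

/-- The Riemann zeta function on real `s > 1`, as the series `∑_{k ≥ 1} k^{-s}`. -/
noncomputable def zetaReal (s : ℝ) : ℝ := ∑' k : ℕ, 1 / ((k : ℝ) + 1) ^ s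

/-- The von Mangoldt weight `ν_Λ(n)` for `n > 1`. -/
noncomputable def nuLambda (n : ℕ) : ℝ :=
  ∫ s in Set.Ioi (1 : ℝ), Real.log n / (zetaReal s * (n : ℝ) ^ s)

open MeasureTheory Set Filter Topology Asymptotics

lemma summable_zetaReal {s : ℝ} (hs : 1 < s) :
    Summable fun k : ℕ => 1 / ((k : ℝ) + 1) ^ s := by
  simpa using (summable_nat_add_iff 1).2 (Real.summable_one_div_nat_rpow.2 hs)

lemma ofReal_zetaReal {s : ℝ} (hs : 1 < s) : (zetaReal s : ℂ) = riemannZeta s := by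
  rw [zeta_eq_tsum_one_div_nat_add_one_cpow (by simpa using hs), zetaReal, Complex.ofReal_tsum]
  refine tsum_congr fun k => ?_
  rw [Complex.ofReal_div, Complex.ofReal_cpow (by positivity)]
  simp

lemma one_le_zetaReal {s : ℝ} (hs : 1 < s) : 1 ≤ zetaReal s := by
  simpa [zetaReal] using (summable_zetaReal hs).le_tsum 0 fun k _ => by positivity

lemma continuousOn_zetaReal : ContinuousOn zetaReal (Ioi 1) := by
  have h : ContinuousOn (fun s : ℝ => (riemannZeta s).re) (Ioi 1) := fun s hs =>
    (Complex.continuous_re.continuousAt.comp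
      ((differentiableAt_riemannZeta (s := (s : ℂ))
        (by exact_mod_cast (mem_Ioi.1 hs).ne')).continuousAt.comp
        Complex.continuous_ofReal.continuousAt)).continuousWithinAt
  exact h.congr fun s hs => by simp [← ofReal_zetaReal hs]

lemma inv_riemannZeta_second_order_isBigO :
    (fun s : ℂ => (riemannZeta s)⁻¹ - (s - 1) + Real.eulerMascheroniConstant * (s - 1) ^ 2)
      =O[𝓝[≠] 1] (fun s => (s - 1) ^ 3) := by
  set γ : ℂ := (Real.eulerMascheroniConstant : ℂ) with hγ
  let h : ℂ → ℂ := fun s =>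
    (-(riemannZeta₀ s - γ) + γ * (s - 1) * riemannZeta₀ s) * (riemannZeta₁ s)⁻¹
  have hd : DifferentiableAt ℂ h 1 := by
    have h₁ : DifferentiableAt ℂ (fun s => (riemannZeta₁ s)⁻¹) 1 :=
      (differentiable_riemannZeta₁.differentiableAt (x := 1)).inv (by simp)
    fun_prop
  have hO : h =O[𝓝 1] (· - 1) := by
    simpa [h, hγ] using hd.isBigO_sub
  have hO' : (fun s => (s - 1) ^ 2 * h s) =O[𝓝[≠] 1] (fun s => (s - 1) ^ 3) := by
    refine (((isBigO_refl (fun s : ℂ => (s - 1) ^ 2) (𝓝 1)).mul hO).mono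
      nhdsWithin_le_nhds).congr_right fun s => ?_
    ring
  refine hO'.congr' ?_ .rfl
  filter_upwards [inv_riemannZeta_eq_sub_mul,
    riemannZeta₁_ne_zero_of_near_one.filter_mono nhdsWithin_le_nhds] with s hs h0
  rw [hs]
  simp only [h]
  field_simp
  rw [riemannZeta₁]
  ring

lemma exists_abs_inv_zetaReal_sub_le :
    ∃ K : ℝ, ∀ s : ℝ, 1 < s →
      |(zetaReal s)⁻¹ - (s - 1) + Real.eulerMascheroniConstant * (s - 1) ^ 2|
        ≤ K * (s - 1) ^ 3 := by
  have ht : Tendsto (fun s : ℝ => (s : ℂ)) (𝓝[>] 1) (𝓝[≠] 1) := by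
    refine tendsto_nhdsWithin_iff.2 ⟨?_, ?_⟩
    · exact (Complex.continuous_ofReal.tendsto' 1 1 (by simp)).mono_left nhdsWithin_le_nhds
    · filter_upwards [self_mem_nhdsWithin] with s hs
      exact mem_compl_singleton_iff.2 (by exact_mod_cast (mem_Ioi.1 hs).ne')
  obtain ⟨c, hc⟩ := (inv_riemannZeta_second_order_isBigO.comp_tendsto ht).bound
  obtain ⟨b, hb, hbc⟩ := mem_nhdsGT_iff_exists_Ioo_subset.1 hc
  have hb : 1 < b := hb
  set γ := Real.eulerMascheroniConstant
  set d := b - 1 with hd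
  have hd0 : 0 < d := by linarith
  refine ⟨max c (1 / d ^ 3 + 1 / d ^ 2 + |γ| / d), fun s hs => ?_⟩
  have hu : 0 < s - 1 := by linarith
  rcases lt_or_ge s b with hsb | hsb
  · have h := hbc ⟨hs, hsb⟩
    simp only [mem_ofPred_eq, Function.comp_apply, ← ofReal_zetaReal hs] at h
    norm_cast at h
    rw [Real.norm_eq_abs, Real.norm_eq_abs, abs_of_pos (a := (s - 1) ^ 3) (by positivity)] at h
    exact h.trans (by gcongr; exact le_max_left _ _)
  · have hz := one_le_zetaReal hs
    have hi : |(zetaReal s)⁻¹| ≤ 1 := by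
      rw [abs_of_pos (by positivity)]
      exact inv_le_one_of_one_le₀ hz
    have hdu : 1 ≤ (s - 1) / d := (one_le_div hd0).2 (by linarith)
    calc _ ≤ |(zetaReal s)⁻¹| + |s - 1| + |γ * (s - 1) ^ 2| :=
          (abs_add_le _ _).trans (by gcongr; exact abs_sub _ _)
      _ ≤ 1 + (s - 1) + |γ| * (s - 1) ^ 2 := by
          rw [abs_mul, abs_of_pos hu, abs_of_pos (a := (s - 1) ^ 2) (by positivity)]
          gcongr
      _ ≤ ((s - 1) / d) ^ 3 + (s - 1) * ((s - 1) / d) ^ 2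
            + |γ| * (s - 1) ^ 2 * ((s - 1) / d) := by
          refine add_le_add (add_le_add (one_le_pow₀ hdu) ?_) ?_
          · exact le_mul_of_one_le_right hu.le (one_le_pow₀ hdu)
          · exact le_mul_of_one_le_right (by positivity) hdu
      _ = (1 / d ^ 3 + 1 / d ^ 2 + |γ| / d) * (s - 1) ^ 3 := by
          field_simp
      _ ≤ _ := by gcongr; exact le_max_right _ _

lemma integral_pow_sub_one_mul_exp (k : ℕ) {L : ℝ} (hL : 0 < L) :
    ∫ s in Ioi (1 : ℝ), (s - 1) ^ k * Real.exp (-(L * (s - 1))) = k.factorial / L ^ (k + 1) := by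
  have h := (measurePreserving_sub_right volume (1 : ℝ)).setIntegral_preimage_emb
    (measurableEmbedding_subRight 1) (fun t : ℝ => t ^ k * Real.exp (-(L * t))) (Ioi 0)
  have hpre : (fun x : ℝ => x - 1) ⁻¹' Ioi 0 = Ioi 1 := by ext; simp
  rw [hpre] at h
  rw [h]
  have hk := Real.integral_rpow_mul_exp_neg_mul_Ioi (a := (k : ℝ) + 1) (by positivity) hL
  rw [Real.Gamma_nat_eq_factorial] at hk
  simp only [add_sub_cancel_right, Real.rpow_natCast] at hk
  rw [hk, ← Nat.cast_add_one, Real.rpow_natCast, one_div, inv_pow,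
    div_eq_inv_mul]

lemma integrableOn_pow_sub_one_mul_exp (k : ℕ) {L : ℝ} (hL : 0 < L) :
    IntegrableOn (fun s : ℝ => (s - 1) ^ k * Real.exp (-(L * (s - 1)))) (Ioi 1) :=
  .of_integral_ne_zero (by rw [integral_pow_sub_one_mul_exp k hL]; positivity)

lemma nuLambda_eq {n : ℕ} (hn : 2 ≤ n) :
    nuLambda n = Real.log n / n *
      ∫ s in Ioi (1 : ℝ), (zetaReal s)⁻¹ * Real.exp (-(Real.log n * (s - 1))) := by
  have hn0 : (0 : ℝ) < n := by positivity
  rw [nuLambda, ← integral_const_mul]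
  refine setIntegral_congr_fun measurableSet_Ioi fun s _ => ?_
  have h : (n : ℝ) ^ s = n * Real.exp (Real.log n * (s - 1)) := by
    rw [← Real.rpow_def_of_pos hn0, Real.rpow_sub_one hn0.ne']
    field_simp
  simp only [h, Real.exp_neg]
  field_simp

lemma abs_integral_inv_zetaReal_sub_le {K L : ℝ} (hL : 0 < L)
    (hK : ∀ s : ℝ, 1 < s →
      |(zetaReal s)⁻¹ - (s - 1) + Real.eulerMascheroniConstant * (s - 1) ^ 2|
        ≤ K * (s - 1) ^ 3) :
    |(∫ s in Ioi (1 : ℝ), (zetaReal s)⁻¹ * Real.exp (-(L * (s - 1))))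
        - (1 / L ^ 2 - 2 * Real.eulerMascheroniConstant / L ^ 3)| ≤ 6 * K / L ^ 4 := by
  set γ := Real.eulerMascheroniConstant
  let R : ℝ → ℝ := fun s =>
    ((zetaReal s)⁻¹ - (s - 1) + γ * (s - 1) ^ 2) * Real.exp (-(L * (s - 1)))
  have hbound : ∀ᵐ s ∂volume.restrict (Ioi (1 : ℝ)),
      ‖R s‖ ≤ K * ((s - 1) ^ 3 * Real.exp (-(L * (s - 1)))) := by
    filter_upwards [ae_restrict_mem measurableSet_Ioi] with s hs
    rw [Real.norm_eq_abs, abs_mul, Real.abs_exp, ← mul_assoc]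
    gcongr
    exact hK s hs
  have i₁ := integrableOn_pow_sub_one_mul_exp 1 hL
  have i₂ := (integrableOn_pow_sub_one_mul_exp 2 hL).const_mul γ
  have i₃ := (integrableOn_pow_sub_one_mul_exp 3 hL).const_mul K
  have hR : IntegrableOn R (Ioi 1) := by
    refine i₃.mono' (ContinuousOn.aestronglyMeasurable ?_ measurableSet_Ioi) hbound
    have hinv : ContinuousOn (fun s => (zetaReal s)⁻¹) (Ioi 1) :=
      continuousOn_zetaReal.inv₀ fun s hs => (zero_lt_one.trans_le (one_le_zetaReal hs)).ne'
    exact ((hinv.sub (by fun_prop)).add (by fun_prop)).mul (by fun_prop)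
  have hsplit : ∫ s in Ioi (1 : ℝ), (zetaReal s)⁻¹ * Real.exp (-(L * (s - 1)))
      = (1 / L ^ 2 - 2 * γ / L ^ 3) + ∫ s in Ioi (1 : ℝ), R s := by
    calc _ = ∫ s in Ioi (1 : ℝ), (((s - 1) ^ 1 * Real.exp (-(L * (s - 1)))
            - γ * ((s - 1) ^ 2 * Real.exp (-(L * (s - 1))))) + R s) := by
          congr 1 with s
          simp only [R]
          ring
      _ = _ := by
          rw [integral_add (by exact i₁.sub i₂) hR, integral_sub i₁ i₂, integral_const_mul,
            integral_pow_sub_one_mul_exp 1 hL, integral_pow_sub_one_mul_exp 2 hL]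
          norm_num [Nat.factorial]
          ring
  rw [hsplit, add_sub_cancel_left, ← Real.norm_eq_abs]
  refine (norm_integral_le_of_norm_le i₃ hbound).trans_eq ?_
  rw [integral_const_mul, integral_pow_sub_one_mul_exp 3 hL]
  norm_num [Nat.factorial]
  ring

theorem nuLambda_asymptotic :
    ∃ C : ℝ, ∀ n : ℕ, 2 ≤ n →
      |nuLambda n - (1 - 2 * Real.eulerMascheroniConstant / Real.log n) *
          (1 / ((n : ℝ) * Real.log n))| ≤ C / ((n : ℝ) * (Real.log n) ^ 3) := by
  obtain ⟨K, hK⟩ := exists_abs_inv_zetaReal_sub_le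
  refine ⟨6 * K, fun n hn => ?_⟩
  have hn0 : (0 : ℝ) < n := by positivity
  have hL : 0 < Real.log n := Real.log_pos (by exact_mod_cast hn)
  have hmain : (1 - 2 * Real.eulerMascheroniConstant / Real.log n) * (1 / ((n : ℝ) * Real.log n))
      = Real.log n / n * (1 / Real.log n ^ 2
        - 2 * Real.eulerMascheroniConstant / Real.log n ^ 3) := by
    field_simp
  rw [nuLambda_eq hn, hmain, ← mul_sub, abs_mul, abs_of_pos (by positivity)]
  calc _ ≤ Real.log n / n * (6 * K / Real.log n ^ 4) := by
        gcongr
        exact abs_integral_inv_zetaReal_sub_le hL hK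
    _ = _ := by field_simp
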